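/- arXiv:math/0601175 — 2 statements merged into one kernel-verified Lean document; each statement's English description precedes it below -/
import Mathlib

section
/- Let F be a field and π ∈ F[t] a monic irreducible polynomial with residue field κ(π) = F[t]/(π). There exists a unique group homomorphism ∂_π : K^M_n(F(t)) → K^M_{n-1}(κ(π)) (the tame symbol) such that ∂_π({π, x_2, ..., x_n}) = {x̄_2, ..., x̄_n} whenever x_2, ..., x_n ∈ F[t] are coprime to π, and ∂_π({x_1, ..., x_n}) = 0 whenever all x_i ∈ F[t] are coprime to π. -/
open Polynomial

/-- Milnor K-theory in degree `n` of a commutative ring `R` (used for fields and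
their residue rings): the free abelian group on `n`-tuples of units modulo
multilinearity and the Steinberg relations `{…, f, 1-f, …} = 0` in adjacent slots. -/
def MilnorRel (R : Type*) [CommRing R] (n : ℕ) :
    AddSubgroup (FreeAbelianGroup (Fin n → Rˣ)) :=
  AddSubgroup.closure
    ({x | ∃ (f : Fin n → Rˣ) (i : Fin n) (a b : Rˣ), f i = a * b ∧
        x = FreeAbelianGroup.of f - FreeAbelianGroup.of (Function.update f i a)
          - FreeAbelianGroup.of (Function.update f i b)} ∪
     {x | ∃ (f : Fin n → Rˣ) (i j : Fin n), (i : ℕ) + 1 = (j : ℕ) ∧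
        ((f i : R) + (f j : R) = 1) ∧ x = FreeAbelianGroup.of f})

def MilnorK (R : Type*) [CommRing R] (n : ℕ) :=
  FreeAbelianGroup (Fin n → Rˣ) ⧸ MilnorRel R n

instance (R : Type*) [CommRing R] (n : ℕ) : AddCommGroup (MilnorK R n) :=
  QuotientAddGroup.Quotient.addCommGroup _

/-- The symbol `{f_1, …, f_n}`. -/
def MilnorSymbol {R : Type*} [CommRing R] {n : ℕ} (f : Fin n → Rˣ) : MilnorK R n :=
  QuotientAddGroup.mk (FreeAbelianGroup.of f)

/-- `D : K^M_{n+1}(F(t)) → K^M_n(F[t]/(π))` is the tame symbol at the monic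
irreducible `π ∈ F[t]`: it sends `{π, x_2, …, x_{n+1}}` to `{x̄_2, …, x̄_{n+1}}`
for `x_i ∈ F[t]` coprime to `π`, and kills symbols all of whose entries come from
polynomials coprime to `π`. -/
def IsTameSymbol (F : Type*) [Field F] (n : ℕ) (π : F[X])
    (D : MilnorK (RatFunc F) (n + 1) →+ MilnorK (F[X] ⧸ Ideal.span {π}) n) : Prop :=
  (∀ x : Fin n → F[X], (∀ i, IsCoprime (x i) π) →
    ∀ (u : Fin (n + 1) → (RatFunc F)ˣ) (v : Fin n → (F[X] ⧸ Ideal.span {π})ˣ),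
      (u 0 : RatFunc F) = algebraMap F[X] (RatFunc F) π →
      (∀ i : Fin n, (u i.succ : RatFunc F) = algebraMap F[X] (RatFunc F) (x i)) →
      (∀ i, (v i : F[X] ⧸ Ideal.span {π}) = Ideal.Quotient.mk (Ideal.span {π}) (x i)) →
      D (MilnorSymbol u) = MilnorSymbol v) ∧
  (∀ x : Fin (n + 1) → F[X], (∀ i, IsCoprime (x i) π) →
    ∀ u : Fin (n + 1) → (RatFunc F)ˣ,
      (∀ i, (u i : RatFunc F) = algebraMap F[X] (RatFunc F) (x i)) →
      D (MilnorSymbol u) = 0)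

namespace MilnorK

section Symbols

variable {R : Type*} [CommRing R] {n : ℕ}

theorem symbol_eq_add (f : Fin n → Rˣ) (i : Fin n) (a b : Rˣ) (h : f i = a * b) :
    MilnorSymbol f =
      MilnorSymbol (Function.update f i a) + MilnorSymbol (Function.update f i b) := by
  have hmem : FreeAbelianGroup.of f - FreeAbelianGroup.of (Function.update f i a)
      - FreeAbelianGroup.of (Function.update f i b) ∈ MilnorRel R n :=
    AddSubgroup.subset_closure (Or.inl ⟨f, i, a, b, h, rfl⟩)
  have h0 := (QuotientAddGroup.eq_zero_iff _).2 hmem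
  have h1 : (MilnorSymbol f - MilnorSymbol (Function.update f i a)
      - MilnorSymbol (Function.update f i b) : MilnorK R n) = 0 := h0
  rw [sub_sub, sub_eq_zero] at h1
  exact h1

theorem symbol_eq_zero_of_add_eq_one (f : Fin n → Rˣ) (i j : Fin n)
    (hij : (i : ℕ) + 1 = (j : ℕ)) (h : (f i : R) + (f j : R) = 1) :
    (MilnorSymbol f : MilnorK R n) = 0 :=
  (QuotientAddGroup.eq_zero_iff _).2
    (AddSubgroup.subset_closure (Or.inr ⟨f, i, j, hij, h, rfl⟩))

/-- The universal property of `MilnorK R n`. -/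
def lift {A : Type*} [AddCommGroup A] (g : (Fin n → Rˣ) → A)
    (hmul : ∀ f i a b, f i = a * b →
      g f = g (Function.update f i a) + g (Function.update f i b))
    (hst : ∀ (f : Fin n → Rˣ) (i j : Fin n), (i : ℕ) + 1 = (j : ℕ) →
      (f i : R) + (f j : R) = 1 → g f = 0) : MilnorK R n →+ A :=
  QuotientAddGroup.lift (MilnorRel R n) (FreeAbelianGroup.lift g) (by
    rw [MilnorRel, AddSubgroup.closure_le]
    rintro x (⟨f, i, a, b, h, rfl⟩ | ⟨f, i, j, hij, h, rfl⟩)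
    · simp [hmul f i a b h]
    · simp [hst f i j hij h])

@[simp]
theorem lift_symbol {A : Type*} [AddCommGroup A] (g : (Fin n → Rˣ) → A) (hmul hst)
    (f : Fin n → Rˣ) : lift g hmul hst (MilnorSymbol f) = g f :=
  (QuotientAddGroup.lift_mk _ _ _).trans (FreeAbelianGroup.lift_apply_of _ _)

theorem hom_ext {A : Type*} [AddCommGroup A] {D E : MilnorK R n →+ A}
    (h : ∀ f, D (MilnorSymbol f) = E (MilnorSymbol f)) : D = E :=
  QuotientAddGroup.addMonoidHom_ext _ (FreeAbelianGroup.lift_ext _ _ h)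

/-- Left multiplication by the symbol `{a}`. -/
def cons (a : Rˣ) : MilnorK R n →+ MilnorK R (n + 1) :=
  lift (fun f => MilnorSymbol (Fin.cons a f : Fin (n + 1) → Rˣ))
    (fun f i b c h => by
      rw [symbol_eq_add _ i.succ b c (by simpa using h), Fin.cons_update, Fin.cons_update])
    (fun f i j hij h => symbol_eq_zero_of_add_eq_one _ i.succ j.succ (by simpa using hij)
      (by simpa using h))

@[simp]
theorem cons_symbol (a : Rˣ) (f : Fin n → Rˣ) :
    cons a (MilnorSymbol f) = MilnorSymbol (Fin.cons a f : Fin (n + 1) → Rˣ) :=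
  lift_symbol _ _ _ _

theorem symbol_eq_cons (f : Fin (n + 1) → Rˣ) :
    MilnorSymbol f = cons (f 0) (MilnorSymbol (Fin.tail f)) := by
  rw [cons_symbol, Fin.cons_self_tail]

theorem cons_mul (a b : Rˣ) (z : MilnorK R n) : cons (a * b) z = cons a z + cons b z := by
  suffices h : cons (a * b) = cons a + (cons b : MilnorK R n →+ _) by rw [h]; rfl
  refine hom_ext fun f => ?_
  rw [AddMonoidHom.add_apply, cons_symbol, symbol_eq_add _ 0 a b (by simp),
    Fin.update_cons_zero, Fin.update_cons_zero, cons_symbol, cons_symbol]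

@[simp]
theorem cons_one (z : MilnorK R n) : cons 1 z = 0 := by
  have h := cons_mul 1 1 z
  rwa [mul_one, left_eq_add] at h

theorem cons_inv (a : Rˣ) (z : MilnorK R n) : cons a⁻¹ z = -cons a z := by
  rw [eq_neg_iff_add_eq_zero, ← cons_mul, inv_mul_cancel, cons_one]

theorem two_zsmul_cons_neg_one (z : MilnorK R n) : (2 : ℤ) • cons (-1) z = 0 := by
  rw [two_zsmul, ← cons_mul, neg_mul_neg, one_mul, cons_one]

theorem cons_cons_of_add_eq_one {a b : Rˣ} (h : (a : R) + (b : R) = 1) (z : MilnorK R n) :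
    cons a (cons b z) = 0 := by
  suffices h : (cons a).comp (cons b) = (0 : MilnorK R n →+ _) from DFunLike.congr_fun h z
  refine hom_ext fun f => ?_
  rw [AddMonoidHom.comp_apply, cons_symbol, cons_symbol]
  exact symbol_eq_zero_of_add_eq_one _ 0 1 (by simp) (by simpa using h)

theorem cons_cons_neg (hR : IsField R) (a : Rˣ) (z : MilnorK R n) :
    cons a (cons (-a) z) = 0 := by
  by_cases h1 : a = 1
  · rw [h1, cons_one]
  have key : ∀ c : Rˣ, c ≠ 1 → ∃ d : Rˣ, (d : R) = 1 - c := fun c hc => by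
    have hne : (1 : R) - c ≠ 0 := fun h => hc (Units.ext (by simpa using (sub_eq_zero.1 h).symm))
    obtain ⟨e, he⟩ := hR.mul_inv_cancel hne
    exact ⟨Units.mkOfMulEqOne _ _ he, rfl⟩
  obtain ⟨d, hd⟩ := key a h1
  obtain ⟨e, he⟩ := key a⁻¹ (by simpa using h1)
  have hde : -a = d * e⁻¹ := by
    rw [eq_mul_inv_iff_mul_eq]
    ext
    simp only [Units.val_mul, Units.val_neg, hd, he, mul_sub, mul_one, neg_mul, Units.mul_inv]
    ring
  have ha := cons_cons_of_add_eq_one (a := a⁻¹) (b := e) (by rw [he]; ring) z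
  rw [cons_inv, neg_eq_zero] at ha
  rw [hde, cons_mul, cons_inv, map_add, map_neg, ha,
    cons_cons_of_add_eq_one (by rw [hd]; ring)]
  simp

theorem cons_cons_self (hR : IsField R) (a : Rˣ) (z : MilnorK R n) :
    cons a (cons a z) = cons a (cons (-1) z) := by
  have h := cons_cons_neg hR a (z := z)
  rw [← neg_one_mul a, cons_mul, map_add] at h
  have h2 : cons a (cons (-1) z) + cons a (cons (-1) z) = 0 := by
    rw [← map_add, ← two_zsmul, two_zsmul_cons_neg_one, map_zero]
  exact add_left_cancel (h.trans h2.symm)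

theorem cons_cons_swap (hR : IsField R) (a b : Rˣ) (z : MilnorK R n) :
    cons a (cons b z) = -cons b (cons a z) := by
  have h := cons_cons_neg hR (a * b) (z := z)
  rw [show -(a * b) = -a * b by rw [neg_mul], cons_mul, cons_mul, map_add, map_add,
    cons_cons_neg hR, zero_add, ← neg_one_mul a, cons_mul, map_add, cons_cons_self hR b,
    ← add_assoc] at h
  have h2 : cons b (cons (-1) z) + cons b (cons (-1) z) = 0 := by
    rw [← map_add, ← two_zsmul, two_zsmul_cons_neg_one, map_zero]
  have h3 : cons a (cons b z) + cons b (cons a z)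
      + (cons b (cons (-1) z) + cons b (cons (-1) z)) = 0 := by
    rw [← h]; abel
  rw [h2, add_zero] at h3
  exact eq_neg_of_add_eq_zero_left h3

theorem symbol_eq_zero_of_adjacent {P : Rˣ → Rˣ → Prop}
    (hP : ∀ (m : ℕ) (a b : Rˣ) (z : MilnorK R m), P a b → cons a (cons b z) = 0)
    (f : Fin n → Rˣ) (i j : Fin n) (hij : (i : ℕ) + 1 = (j : ℕ)) (h : P (f i) (f j)) :
    (MilnorSymbol f : MilnorK R n) = 0 := by
  induction n with
  | zero => exact i.elim0
  | succ n ih =>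
    rw [symbol_eq_cons]
    obtain ⟨j, rfl⟩ := Fin.exists_succ_eq.2 (show j ≠ 0 by rintro rfl; simp at hij)
    cases i using Fin.cases with
    | zero =>
      cases n with
      | zero => exact j.elim0
      | succ n =>
        obtain rfl : j = 0 := by ext; simpa using hij.symm
        rw [symbol_eq_cons (Fin.tail f)]
        exact hP _ _ _ _ h
    | succ i => rw [ih (Fin.tail f) i j (by simpa using hij) h, map_zero]

end Symbols

end MilnorK

/-- A discrete valuation `v` on the units of `Q` together with the specialization map
`s` attached to a uniformizer `π`, sending `π ^ m * w` to the residue class of `w`. -/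
structure SpecializationData (Q κ : Type*) [CommRing Q] [CommRing κ] where
  v : Qˣ → ℤ
  s : Qˣ →* κˣ
  v_mul : ∀ x y, v (x * y) = v x + v y
  of_add_eq_one : ∀ x y : Qˣ, (x : Q) + (y : Q) = 1 →
    (v x = 0 ∧ v y = 0 ∧ (s x : κ) + (s y : κ) = 1) ∨ (v x = 0 ∧ s x = 1) ∨
      (v y = 0 ∧ s y = 1) ∨ (v x = v y ∧ s y = -s x)

namespace SpecializationData

open MilnorK

variable {Q κ : Type*} [CommRing Q] [CommRing κ] (T : SpecializationData Q κ)

theorem symbol_comp_eq_add {n : ℕ} (f : Fin n → Qˣ) (i : Fin n) (a b : Qˣ)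
    (h : f i = a * b) :
    MilnorSymbol (T.s ∘ f) = MilnorSymbol (T.s ∘ Function.update f i a)
      + MilnorSymbol (T.s ∘ Function.update f i b) := by
  rw [symbol_eq_add (T.s ∘ f) i (T.s a) (T.s b) (by simp [h]), Function.comp_update,
    Function.comp_update]

theorem symbol_comp_eq_zero (hκ : IsField κ) {n : ℕ} (f : Fin n → Qˣ) (i j : Fin n)
    (hij : (i : ℕ) + 1 = (j : ℕ)) (h : (f i : Q) + (f j : Q) = 1) :
    (MilnorSymbol (T.s ∘ f) : MilnorK κ n) = 0 := by
  refine symbol_eq_zero_of_adjacent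
    (P := fun a b => (a : κ) + (b : κ) = 1 ∨ a = 1 ∨ b = 1 ∨ b = -a) ?_ _ i j hij ?_
  · rintro m a b z (h | rfl | rfl | rfl)
    · exact cons_cons_of_add_eq_one h z
    · exact cons_one _
    · rw [cons_one, map_zero]
    · exact cons_cons_neg hκ a z
  · have := T.of_add_eq_one _ _ h
    simp only [Function.comp_apply]
    tauto

/-- The specialization map attached to the uniformizer `-π`. -/
def twist : Qˣ →* κˣ where
  toFun x := T.s x * (-1) ^ T.v x
  map_one' := by
    have h := T.v_mul 1 1
    rw [mul_one, left_eq_add] at h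
    simp [h]
  map_mul' x y := by rw [map_mul, T.v_mul, zpow_add, mul_mul_mul_comm]

theorem twist_apply (x : Qˣ) : T.twist x = T.s x * (-1) ^ T.v x := rfl

/-- The residue of a symbol, expanded along its first entry. -/
def residue : (n : ℕ) → (Fin (n + 1) → Qˣ) → MilnorK κ n
  | 0, u => T.v (u 0) • MilnorSymbol (T.s ∘ Fin.tail u)
  | n + 1, u => T.v (u 0) • MilnorSymbol (T.s ∘ Fin.tail u)
      - cons (T.twist (u 0)) (residue n (Fin.tail u))

theorem residue_eq_add {n : ℕ} (f : Fin (n + 1) → Qˣ) (i : Fin (n + 1)) (a b : Qˣ)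
    (h : f i = a * b) :
    T.residue n f = T.residue n (Function.update f i a)
      + T.residue n (Function.update f i b) := by
  induction n with
  | zero =>
    obtain rfl : i = 0 := Fin.eq_zero i
    simp only [residue, Fin.tail_update_zero, Function.update_self, h, T.v_mul, add_smul]
  | succ n ih =>
    cases i using Fin.cases with
    | zero =>
      simp only [residue, Fin.tail_update_zero, Function.update_self, h, T.v_mul, add_smul,
        map_mul, cons_mul]
      abel
    | succ i =>
      have h0 : ∀ c, Function.update f i.succ c 0 = f 0 := fun c =>
        Function.update_of_ne (Fin.succ_ne_zero i).symm _ _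
      simp only [residue, Fin.tail_update_succ, h0]
      rw [ih (Fin.tail f) i h, T.symbol_comp_eq_add (Fin.tail f) i a b h, map_add, smul_add]
      abel

theorem zsmul_cons_neg {n : ℕ} (k : ℤ) (a : κˣ) (z : MilnorK κ n) :
    k • cons (-a) z = k • cons (a * (-1) ^ k) z := by
  rcases Int.even_or_odd' k with ⟨c, rfl | rfl⟩
  · rw [← mul_neg_one, cons_mul, smul_add, mul_comm 2 c, mul_smul c 2 (cons (-1) z),
      two_zsmul_cons_neg_one, mul_comm c 2, zpow_mul]
    simp
  · rw [zpow_add, zpow_mul]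
    simp

theorem exists_residue_eq_sub (n : ℕ) (u : Fin (n + 1) → Qˣ) :
    ∃ e : MilnorK κ n, T.residue n u = T.v (u 0) • MilnorSymbol (T.s ∘ Fin.tail u) - e ∧
      ∀ c : κˣ, (∀ (m : ℕ) (w : MilnorK κ m), cons c (cons (T.twist (u 0)) w) = 0) →
        cons c e = 0 := by
  cases n with
  | zero => exact ⟨0, by rw [residue, sub_zero], fun c _ => map_zero _⟩
  | succ n => exact ⟨_, rfl, fun c hc => hc _ _⟩

theorem residue_eq_zero_of_head_add_eq_one (hκ : IsField κ) {n : ℕ} (f : Fin (n + 2) → Qˣ)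
    (h : (f 0 : Q) + (f 1 : Q) = 1) : T.residue (n + 1) f = 0 := by
  obtain ⟨e, he, hc⟩ := T.exists_residue_eq_sub n (Fin.tail f)
  have h1 : Fin.tail f 0 = f 1 := rfl
  have hs : MilnorSymbol (T.s ∘ Fin.tail f)
      = cons (T.s (f 1)) (MilnorSymbol (T.s ∘ Fin.tail (Fin.tail f)) : MilnorK κ n) :=
    symbol_eq_cons _
  rw [residue, he, hs, h1, map_sub]
  rw [h1] at hc
  generalize (MilnorSymbol (T.s ∘ Fin.tail (Fin.tail f)) : MilnorK κ n) = z
  rcases T.of_add_eq_one _ _ h with ⟨hv0, hv1, hadd⟩ | ⟨hv0, hs0⟩ | ⟨hv1, hs1⟩ | ⟨hv, hneg⟩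
  · rw [hc _ fun m w => cons_cons_of_add_eq_one (by simpa [twist_apply, hv0, hv1] using hadd) w]
    simp [hv0, hv1]
  · simp [twist_apply, hv0, hs0]
  · rw [hc _ fun m w => by simp [twist_apply, hv1, hs1]]
    simp [hv1, hs1]
  · have htw : T.twist (f 1) = -T.twist (f 0) := by
      rw [twist_apply, twist_apply, hneg, hv, neg_mul]
    rw [hc _ fun m w => by rw [htw, cons_cons_neg hκ], hneg, hv, zsmul_cons_neg, twist_apply, hv,
      map_zsmul, sub_zero, sub_self]

theorem residue_eq_zero (hκ : IsField κ) {n : ℕ} (f : Fin (n + 1) → Qˣ) (i j : Fin (n + 1))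
    (hij : (i : ℕ) + 1 = (j : ℕ)) (h : (f i : Q) + (f j : Q) = 1) : T.residue n f = 0 := by
  induction n with
  | zero => omega
  | succ n ih =>
    obtain ⟨j, rfl⟩ := Fin.exists_succ_eq.2 (show j ≠ 0 by rintro rfl; simp at hij)
    cases i using Fin.cases with
    | zero =>
      obtain rfl : j = 0 := by ext; simpa using hij.symm
      exact T.residue_eq_zero_of_head_add_eq_one hκ f h
    | succ i =>
      have hij' : (i : ℕ) + 1 = (j : ℕ) := by simpa using hij
      rw [residue, ih (Fin.tail f) i j hij' h,
        T.symbol_comp_eq_zero hκ (Fin.tail f) i j hij' h]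
      simp

/-- The residue homomorphism in Milnor K-theory. -/
def residueHom (hκ : IsField κ) (n : ℕ) : MilnorK Q (n + 1) →+ MilnorK κ n :=
  lift (T.residue n) (fun f i a b => T.residue_eq_add f i a b)
    (fun f i j => T.residue_eq_zero hκ f i j)

theorem residueHom_symbol (hκ : IsField κ) (n : ℕ) (u : Fin (n + 1) → Qˣ) :
    T.residueHom hκ n (MilnorSymbol u) = T.residue n u :=
  lift_symbol _ _ _ _

theorem residue_of_v_eq_zero {n : ℕ} (u : Fin (n + 1) → Qˣ) (h : ∀ i, T.v (u i) = 0) :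
    T.residue n u = 0 := by
  induction n with
  | zero => rw [residue, h, zero_smul]
  | succ n ih => rw [residue, h, zero_smul, ih (Fin.tail u) fun i => h i.succ, map_zero, sub_zero]

theorem residue_of_uniformizer {n : ℕ} (u : Fin (n + 1) → Qˣ) (h0 : T.v (u 0) = 1)
    (h : ∀ i : Fin n, T.v (u i.succ) = 0) :
    T.residue n u = MilnorSymbol (T.s ∘ Fin.tail u) := by
  cases n with
  | zero => rw [residue, h0, one_smul]
  | succ n =>
    rw [residue, h0, one_smul, T.residue_of_v_eq_zero (Fin.tail u) h, map_zero, sub_zero]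

end SpecializationData

namespace MilnorK

variable {Q : Type*} [CommRing Q]

theorem mem_of_symbol_mem {n : ℕ} {H : AddSubgroup (MilnorK Q n)}
    (h : ∀ f, MilnorSymbol f ∈ H) (z : MilnorK Q n) : z ∈ H := by
  have hq : QuotientAddGroup.mk' H = 0 :=
    hom_ext fun f => (QuotientAddGroup.eq_zero_iff _).2 (h f)
  exact (QuotientAddGroup.eq_zero_iff z).1 (DFunLike.congr_fun hq z)

theorem cons_mem_of_closure_eq_top {n : ℕ} {S : Set Qˣ} (hS : Subgroup.closure S = ⊤)
    (H : AddSubgroup (MilnorK Q (n + 1))) (z : MilnorK Q n) (h : ∀ x ∈ S, cons x z ∈ H)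
    (x : Qˣ) : cons x z ∈ H := by
  have hx : x ∈ Subgroup.closure S := hS ▸ Subgroup.mem_top x
  induction hx using Subgroup.closure_induction with
  | mem x hx => exact h x hx
  | one => rw [cons_one]; exact H.zero_mem
  | mul x y _ _ hx hy => rw [cons_mul]; exact H.add_mem hx hy
  | inv x _ hx => rw [cons_inv]; exact H.neg_mem hx

/-- The subgroup generated by the symbols `{x_1, …}` and `{p, x_2, …}` with all `x_i ∈ U`. -/
def normalSubgroup (p : Qˣ) (U : Set Qˣ) (n : ℕ) : AddSubgroup (MilnorK Q (n + 1)) :=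
  AddSubgroup.closure
    ({z | ∃ u : Fin (n + 1) → Qˣ, (∀ i, u i ∈ U) ∧ z = MilnorSymbol u} ∪
     {z | ∃ u : Fin n → Qˣ, (∀ i, u i ∈ U) ∧ z = cons p (MilnorSymbol u)})

theorem symbol_mem_normalSubgroup {p : Qˣ} {U : Set Qˣ} {n : ℕ} {u : Fin (n + 1) → Qˣ}
    (hu : ∀ i, u i ∈ U) : MilnorSymbol u ∈ normalSubgroup p U n :=
  AddSubgroup.subset_closure (Or.inl ⟨u, hu, rfl⟩)

theorem cons_symbol_mem_normalSubgroup {p : Qˣ} {U : Set Qˣ} {n : ℕ} {u : Fin n → Qˣ}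
    (hu : ∀ i, u i ∈ U) : cons p (MilnorSymbol u) ∈ normalSubgroup p U n :=
  AddSubgroup.subset_closure (Or.inr ⟨u, hu, rfl⟩)

theorem mem_normalSubgroup (hQ : IsField Q) {p : Qˣ} {U : Set Qˣ}
    (hU : Subgroup.closure (insert p U) = ⊤) (hneg : -1 ∈ U) (n : ℕ)
    (z : MilnorK Q (n + 1)) : z ∈ normalSubgroup p U n := by
  have hcons : ∀ {m : ℕ} {x : Qˣ} {u : Fin m → Qˣ}, x ∈ U → (∀ i, u i ∈ U) →
      ∀ i, (Fin.cons x u : Fin (m + 1) → Qˣ) i ∈ U := fun hx hu i => by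
    cases i using Fin.cases with
    | zero => exact hx
    | succ i => exact hu i
  induction n with
  | zero =>
    refine mem_of_symbol_mem (fun f => ?_) z
    rw [symbol_eq_cons]
    refine cons_mem_of_closure_eq_top hU _ _ ?_ _
    rintro x (rfl | hx)
    · exact cons_symbol_mem_normalSubgroup fun i => i.elim0
    · rw [cons_symbol]
      exact symbol_mem_normalSubgroup (hcons hx fun i => i.elim0)
  | succ n ih =>
    refine mem_of_symbol_mem (fun f => ?_) z
    rw [symbol_eq_cons]
    refine cons_mem_of_closure_eq_top hU _ _ (fun x hx => ?_) _
    have hz := ih (MilnorSymbol (Fin.tail f))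
    generalize (MilnorSymbol (Fin.tail f) : MilnorK Q (n + 1)) = z at hz
    induction hz using AddSubgroup.closure_induction with
    | mem y hy =>
      rcases hx with rfl | hx <;> obtain ⟨u, hu, rfl⟩ | ⟨u, hu, rfl⟩ := hy
      · exact cons_symbol_mem_normalSubgroup hu
      · rw [cons_cons_self hQ, cons_symbol (-1)]
        exact cons_symbol_mem_normalSubgroup (hcons hneg hu)
      · rw [cons_symbol]
        exact symbol_mem_normalSubgroup (hcons hx hu)
      · rw [cons_cons_swap hQ, cons_symbol x]
        exact neg_mem (cons_symbol_mem_normalSubgroup (hcons hx hu))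
    | zero => rw [map_zero]; exact zero_mem _
    | add y z _ _ hy hz => rw [map_add]; exact add_mem hy hz
    | neg y _ hy => rw [map_neg]; exact neg_mem hy

end MilnorK

section UniformizerDecomposition

variable {R Q : Type*} [CommRing R] [Field Q] [Algebra R Q]

theorem exists_unit_eq_mk {ϖ p : R} (h : IsCoprime p ϖ) :
    ∃ c : (R ⧸ Ideal.span {ϖ})ˣ, (c : R ⧸ Ideal.span {ϖ}) = Ideal.Quotient.mk _ p := by
  obtain ⟨a, b, hab⟩ := h
  refine ⟨Units.mkOfMulEqOne (Ideal.Quotient.mk _ p) (Ideal.Quotient.mk _ a) ?_, rfl⟩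
  rw [← map_mul, ← map_one (Ideal.Quotient.mk (Ideal.span {ϖ})), Ideal.Quotient.eq,
    Ideal.mem_span_singleton']
  exact ⟨-b, by linear_combination -hab⟩

/-- `x = ϖ ^ k * (p / q)` with `p`, `q` coprime to `ϖ`, and `c` is the residue class of
`p / q`. -/
def IsUniformizerDecomposition (ϖ : R) (x : Qˣ) (k : ℤ) (c : (R ⧸ Ideal.span {ϖ})ˣ) : Prop :=
  ∃ p q : R, IsCoprime p ϖ ∧ IsCoprime q ϖ ∧
    (x : Q) * algebraMap R Q q = algebraMap R Q ϖ ^ k * algebraMap R Q p ∧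
    (c : R ⧸ Ideal.span {ϖ}) * Ideal.Quotient.mk _ q = Ideal.Quotient.mk _ p

namespace IsUniformizerDecomposition

variable {ϖ : R} {x y : Qˣ} {k l : ℤ} {c d : (R ⧸ Ideal.span {ϖ})ˣ}

theorem mul (hϖ : algebraMap R Q ϖ ≠ 0) (hx : IsUniformizerDecomposition ϖ x k c)
    (hy : IsUniformizerDecomposition ϖ y l d) :
    IsUniformizerDecomposition ϖ (x * y) (k + l) (c * d) := by
  obtain ⟨p, q, hp, hq, hx, hc⟩ := hx
  obtain ⟨p', q', hp', hq', hy, hd⟩ := hy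
  refine ⟨p * p', q * q', hp.mul_left hp', hq.mul_left hq', ?_, ?_⟩
  · rw [zpow_add₀ hϖ, Units.val_mul, map_mul, map_mul, mul_mul_mul_comm, hx, hy]
    ring
  · rw [Units.val_mul, map_mul, map_mul, mul_mul_mul_comm, hc, hd]

theorem le_and_eq [IsDomain R] [IsFractionRing R Q] (hϖ : Irreducible ϖ)
    (hx : IsUniformizerDecomposition ϖ x k c) (hy : IsUniformizerDecomposition ϖ x l d)
    (hkl : k ≤ l) : k = l ∧ c = d := by
  obtain ⟨p, q, hp, hq, hx, hc⟩ := hx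
  obtain ⟨p', q', hp', hq', hy, hd⟩ := hy
  obtain ⟨m, rfl⟩ := Int.le.dest hkl
  have hinj := IsFractionRing.injective R Q
  have h0 : algebraMap R Q ϖ ≠ 0 := by
    rw [Ne, map_eq_zero_iff _ hinj]; exact hϖ.ne_zero
  have hpq : p * q' = ϖ ^ m * (p' * q) := by
    apply hinj
    apply mul_left_cancel₀ (zpow_ne_zero k h0)
    rw [zpow_add₀ h0, zpow_natCast] at hy
    simp only [map_mul, map_pow]
    linear_combination (-algebraMap R Q q') * hx + (algebraMap R Q q) * hy
  rcases m with _ | m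
  · refine ⟨by simp, ?_⟩
    have h := congrArg (Ideal.Quotient.mk (Ideal.span {ϖ})) hpq
    simp only [pow_zero, one_mul, map_mul, ← hc, ← hd] at h
    obtain ⟨e, he⟩ := exists_unit_eq_mk hq
    obtain ⟨e', he'⟩ := exists_unit_eq_mk hq'
    rw [← he, ← he'] at h
    have h' : c * e * e' = d * e' * e := Units.ext (by simpa using h)
    rw [mul_assoc, mul_assoc, mul_comm e'] at h'
    exact mul_right_cancel h'
  · have hdvd : ϖ ∣ p * q' := ⟨ϖ ^ m * (p' * q), by rw [hpq]; ring⟩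
    exact absurd ((hp.mul_left hq').symm.isUnit_of_dvd' dvd_rfl hdvd) hϖ.not_isUnit

theorem unique [IsDomain R] [IsFractionRing R Q] (hϖ : Irreducible ϖ)
    (hx : IsUniformizerDecomposition ϖ x k c) (hy : IsUniformizerDecomposition ϖ x l d) :
    k = l ∧ c = d := by
  rcases le_total k l with h | h
  · exact le_and_eq hϖ hx hy h
  · obtain ⟨h1, h2⟩ := le_and_eq hϖ hy hx h
    exact ⟨h1.symm, h2.symm⟩

theorem of_coe_eq {p : R} (hp : IsCoprime p ϖ) (hx : (x : Q) = algebraMap R Q p)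
    (hc : (c : R ⧸ Ideal.span {ϖ}) = Ideal.Quotient.mk _ p) :
    IsUniformizerDecomposition ϖ x 0 c :=
  ⟨p, 1, hp, isCoprime_one_left, by simp [hx], by simp [hc]⟩

theorem uniformizer (hx : (x : Q) = algebraMap R Q ϖ) : IsUniformizerDecomposition ϖ x 1 1 :=
  ⟨1, 1, isCoprime_one_left, isCoprime_one_left, by simp [hx], by simp⟩

theorem one_sub_of_pos (hx : IsUniformizerDecomposition ϖ x k c) (hk : 0 < k)
    (h : (x : Q) + y = 1) : IsUniformizerDecomposition ϖ y 0 1 := by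
  obtain ⟨p, q, hp, hq, hx, hc⟩ := hx
  obtain ⟨m, rfl⟩ : ∃ m : ℕ, k = (m + 1 : ℕ) := ⟨(k - 1).toNat, by omega⟩
  rw [zpow_natCast] at hx
  refine ⟨q + ϖ * (-(ϖ ^ m * p)), q, hq.add_mul_left_left _, hq, ?_, ?_⟩
  · simp only [map_add, map_mul, map_neg, map_pow, zpow_zero]
    linear_combination (algebraMap R Q q) * h - hx
  · have : Ideal.Quotient.mk (Ideal.span {ϖ}) ϖ = 0 := Ideal.Quotient.mk_singleton_self ϖ
    rw [map_add, map_mul, this]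
    simp

theorem one_sub_of_neg (hϖ : algebraMap R Q ϖ ≠ 0) (hx : IsUniformizerDecomposition ϖ x k c)
    (hk : k < 0) (h : (x : Q) + y = 1) : IsUniformizerDecomposition ϖ y k (-c) := by
  obtain ⟨p, q, hp, hq, hx, hc⟩ := hx
  obtain ⟨m, rfl⟩ : ∃ m : ℕ, k = -(m + 1 : ℕ) := ⟨(-k - 1).toNat, by omega⟩
  refine ⟨-p + ϖ * (ϖ ^ m * q), q, hp.neg_left.add_mul_left_left _, hq, ?_, ?_⟩
  · have h1 : algebraMap R Q ϖ ^ (-(m + 1 : ℕ) : ℤ) * algebraMap R Q ϖ ^ (m + 1) = 1 := by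
      rw [← zpow_natCast (algebraMap R Q ϖ) (m + 1), ← zpow_add₀ hϖ]
      simp
    simp only [map_add, map_mul, map_neg, map_pow]
    linear_combination (algebraMap R Q q) * h - hx - (algebraMap R Q q) * h1
  · have : Ideal.Quotient.mk (Ideal.span {ϖ}) ϖ = 0 := Ideal.Quotient.mk_singleton_self ϖ
    rw [map_add, map_mul, this, Units.val_neg, neg_mul, hc]
    simp

theorem add_eq_one [IsDomain R] [IsFractionRing R Q] (hx : IsUniformizerDecomposition ϖ x 0 c)
    (hy : IsUniformizerDecomposition ϖ y 0 d) (h : (x : Q) + y = 1) :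
    (c : R ⧸ Ideal.span {ϖ}) + d = 1 := by
  obtain ⟨p, q, hp, hq, hx, hc⟩ := hx
  obtain ⟨p', q', hp', hq', hy, hd⟩ := hy
  have hpq : p * q' + p' * q = q * q' := by
    apply IsFractionRing.injective R Q
    rw [zpow_zero, one_mul] at hx hy
    simp only [map_add, map_mul, ← hx, ← hy]
    linear_combination (algebraMap R Q q * algebraMap R Q q') * h
  have h' := congrArg (Ideal.Quotient.mk (Ideal.span {ϖ})) hpq
  simp only [map_add, map_mul, ← hc, ← hd] at h'
  obtain ⟨e, he⟩ := exists_unit_eq_mk (hq.mul_left hq')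
  rw [map_mul] at he
  apply e.isUnit.mul_right_cancel
  rw [he]
  linear_combination h'

end IsUniformizerDecomposition

variable [IsDomain R] [IsPrincipalIdealRing R] [IsFractionRing R Q]

theorem exists_eq_pow_mul_isCoprime {ϖ : R} (hϖ : Irreducible ϖ) {r : R} (hr : r ≠ 0) :
    ∃ (m : ℕ) (p : R), IsCoprime p ϖ ∧ r = ϖ ^ m * p := by
  obtain ⟨m, p, hp, h⟩ := WfDvdMonoid.max_power_factor hr hϖ
  exact ⟨m, p, ((hϖ.coprime_iff_not_dvd).2 hp).symm, h⟩

theorem exists_eq_zpow_mul_isCoprime {ϖ : R} (hϖ : Irreducible ϖ) (x : Qˣ) :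
    ∃ (k : ℤ) (p q : R), IsCoprime p ϖ ∧ IsCoprime q ϖ ∧
      (x : Q) * algebraMap R Q q = algebraMap R Q ϖ ^ k * algebraMap R Q p := by
  have hinj := IsFractionRing.injective R Q
  obtain ⟨a, b, hb, hab⟩ := IsFractionRing.div_surjective (A := R) (x : Q)
  have hb0 : b ≠ 0 := nonZeroDivisors.ne_zero hb
  have ha0 : a ≠ 0 := by
    rintro rfl
    exact x.ne_zero (by rw [← hab, map_zero, zero_div])
  have h0 : algebraMap R Q ϖ ≠ 0 := by
    rw [Ne, map_eq_zero_iff _ hinj]; exact hϖ.ne_zero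
  have hbQ : algebraMap R Q b ≠ 0 := by rwa [Ne, map_eq_zero_iff _ hinj]
  rw [div_eq_iff hbQ] at hab
  obtain ⟨m, p, hp, rfl⟩ := exists_eq_pow_mul_isCoprime hϖ ha0
  obtain ⟨l, q, hq, rfl⟩ := exists_eq_pow_mul_isCoprime hϖ hb0
  refine ⟨m - l, p, q, hp, hq, ?_⟩
  rw [zpow_sub₀ h0, zpow_natCast, zpow_natCast]
  field_simp
  simp only [map_mul, map_pow] at hab
  linear_combination -hab

theorem exists_isUniformizerDecomposition {ϖ : R} (hϖ : Irreducible ϖ) (x : Qˣ) :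
    ∃ (k : ℤ) (c : (R ⧸ Ideal.span {ϖ})ˣ), IsUniformizerDecomposition ϖ x k c := by
  obtain ⟨k, p, q, hp, hq, h⟩ := exists_eq_zpow_mul_isCoprime hϖ x
  obtain ⟨d, hd⟩ := exists_unit_eq_mk hp
  obtain ⟨e, he⟩ := exists_unit_eq_mk hq
  exact ⟨k, d * e⁻¹, p, q, hp, hq, h, by rw [← he, ← hd]; simp⟩

variable (Q) in
theorem exists_specializationData {ϖ : R} (hϖ : Irreducible ϖ) :
    ∃ T : SpecializationData Q (R ⧸ Ideal.span {ϖ}),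
      ∀ x k c, IsUniformizerDecomposition ϖ x k c → T.v x = k ∧ T.s x = c := by
  have h0 : algebraMap R Q ϖ ≠ 0 := by
    rw [Ne, map_eq_zero_iff _ (IsFractionRing.injective R Q)]; exact hϖ.ne_zero
  choose v s hvs using exists_isUniformizerDecomposition (Q := Q) hϖ
  have huniq : ∀ {x k c}, IsUniformizerDecomposition ϖ x k c → v x = k ∧ s x = c :=
    fun h => (hvs _).unique hϖ h
  have hmul := fun x y => huniq ((hvs x).mul h0 (hvs y))
  refine ⟨⟨v, MonoidHom.mk' s fun x y => (hmul x y).2, fun x y => (hmul x y).1, ?_⟩,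
    fun x k c h => huniq h⟩
  intro x y h
  have h' : (y : Q) + x = 1 := by rw [add_comm, h]
  simp only [MonoidHom.mk'_apply, Units.ext_iff, Units.val_neg]
  rcases lt_trichotomy (v x) 0 with hx | hx | hx
  · obtain ⟨h1, h2⟩ := huniq ((hvs x).one_sub_of_neg h0 hx h)
    simp [h1, h2]
  · rcases lt_trichotomy (v y) 0 with hy | hy | hy
    · obtain ⟨h1, h2⟩ := huniq ((hvs y).one_sub_of_neg h0 hy h')
      simp [h1, h2]
    · exact Or.inl ⟨hx, hy, (hx ▸ hvs x).add_eq_one (hy ▸ hvs y) h⟩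
    · obtain ⟨h1, h2⟩ := huniq ((hvs y).one_sub_of_pos hy h')
      simp [h1, h2]
  · obtain ⟨h1, h2⟩ := huniq ((hvs x).one_sub_of_pos hx h)
    simp [h1, h2]

theorem closure_insert_uniformizer_eq_top {ϖ : R} (hϖ : Irreducible ϖ) (w : Qˣ)
    (hw : (w : Q) = algebraMap R Q ϖ) :
    Subgroup.closure
      (insert w {u : Qˣ | ∃ p : R, IsCoprime p ϖ ∧ (u : Q) = algebraMap R Q p}) = ⊤ := by
  have hne : ∀ {p : R}, IsCoprime p ϖ → algebraMap R Q p ≠ 0 := fun {p} hp => by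
    rw [Ne, map_eq_zero_iff _ (IsFractionRing.injective R Q)]
    rintro rfl
    exact hϖ.not_isUnit (isCoprime_zero_left.1 hp)
  refine eq_top_iff.2 fun x _ => ?_
  obtain ⟨k, p, q, hp, hq, h⟩ := exists_eq_zpow_mul_isCoprime hϖ x
  have hx : x = w ^ k * Units.mk0 _ (hne hp) * (Units.mk0 _ (hne hq))⁻¹ := by
    rw [eq_mul_inv_iff_mul_eq]
    apply Units.ext
    simpa [hw] using h
  rw [hx]
  refine mul_mem (mul_mem (zpow_mem ?_ k) ?_) (inv_mem ?_) <;> apply Subgroup.subset_closure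
  · exact Or.inl rfl
  · exact Or.inr ⟨p, hp, rfl⟩
  · exact Or.inr ⟨q, hq, rfl⟩

end UniformizerDecomposition

/-- for a field `F` and a monic irreducible `π ∈ F[t]` there is a
unique group homomorphism `∂_π : K^M_{n+1}(F(t)) → K^M_n(F[t]/(π))` with
`∂_π{π, x_2, …} = {x̄_2, …}` for the `x_i ∈ F[t]` coprime to `π`, and
`∂_π{x_1, …} = 0` when all `x_i ∈ F[t]` are coprime to `π`. -/
theorem tame_symbol_exists_unique (F : Type*) [Field F] (n : ℕ)
    (π : F[X]) (hπ : π.Monic) (hirr : Irreducible π) :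
    ∃! D : MilnorK (RatFunc F) (n + 1) →+ MilnorK (F[X] ⧸ Ideal.span {π}) n,
      IsTameSymbol F n π D := by
  have hκ : IsField (F[X] ⧸ Ideal.span {π}) :=
    (Ideal.Quotient.maximal_ideal_iff_isField_quotient _).1
      (PrincipalIdealRing.isMaximal_of_irreducible hirr)
  obtain ⟨T, hT⟩ := exists_specializationData (RatFunc F) hirr
  have hE : IsTameSymbol F n π (T.residueHom hκ n) := by
    constructor
    · intro x hx u v hu0 hu hv
      have huv := fun i => hT _ _ _ (.of_coe_eq (hx i) (hu i) (hv i))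
      rw [T.residueHom_symbol, T.residue_of_uniformizer u (hT _ _ _ (.uniformizer hu0)).1
        fun i => (huv i).1]
      exact congrArg MilnorSymbol (funext fun i => (huv i).2)
    · intro x hx u hu
      rw [T.residueHom_symbol, T.residue_of_v_eq_zero u fun i => ?_]
      obtain ⟨c, hc⟩ := exists_unit_eq_mk (hx i)
      exact (hT _ _ _ (.of_coe_eq (hx i) (hu i) hc)).1
  refine ⟨_, hE, ?_⟩
  intro D hD
  have hπ0 : algebraMap F[X] (RatFunc F) π ≠ 0 := by
    rw [Ne, map_eq_zero_iff _ (IsFractionRing.injective F[X] (RatFunc F))]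
    exact hirr.ne_zero
  ext z
  have hz := MilnorK.mem_normalSubgroup (Field.toIsField (RatFunc F))
    (closure_insert_uniformizer_eq_top hirr (Units.mk0 _ hπ0) rfl)
    ⟨-1, isCoprime_one_left.neg_left, by simp⟩ n z
  induction hz using AddSubgroup.closure_induction with
  | mem z hz =>
    obtain ⟨u, hu, rfl⟩ | ⟨u, hu, rfl⟩ := hz <;> choose x hx hux using hu
    · rw [hD.2 x hx u hux, hE.2 x hx u hux]
    · choose v hv using fun i => exists_unit_eq_mk (hx i)
      rw [MilnorK.cons_symbol, hD.1 x hx _ v rfl hux hv, hE.1 x hx _ v rfl hux hv]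
  | zero => rw [map_zero, map_zero]
  | add y z _ _ hy hz => rw [map_add, map_add, hy, hz]
  | neg y _ hy => rw [map_neg, map_neg, hy]
end

section
/- Let F be a field, π ∈ F[t] monic irreducible, L = F[t]/(π), and define the Bass–Tate norm N_{L/F} : K^M_n(L) → K^M_n(F) by: given ξ ∈ K^M_n(L), choose ζ ∈ K^M_{n+1}(F(t)) with ∂_{π'}(ζ) = 0 for all monic irreducible π' ≠ π and ∂_π(ζ) = ξ (possible by Milnor's exact sequence), and set N_{L/F}(ξ) = -∂_{1/t}(ζ). Then N_{L/F}(ξ) is independent of the choice of ζ. -/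
open Polynomial

/-- `D : K^M_{n+1}(F(t)) → K^M_n(F)` is the tame symbol `∂_{1/t}` at the place at
infinity (local parameter `1/t`): it sends `{1/t, x_2(1/t), …}` to
`{x_2(0), …}` for polynomials `x_i` with nonzero constant term, and kills symbols
all of whose entries are polynomials in `1/t` with nonzero constant term. -/
def IsTameSymbolInf (F : Type*) [Field F] (n : ℕ)
    (D : MilnorK (RatFunc F) (n + 1) →+ MilnorK F n) : Prop :=
  (∀ q : Fin n → F[X], (∀ i, (q i).coeff 0 ≠ 0) →
    ∀ (u : Fin (n + 1) → (RatFunc F)ˣ) (v : Fin n → Fˣ),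
      (u 0 : RatFunc F) = (RatFunc.X)⁻¹ →
      (∀ i : Fin n, (u i.succ : RatFunc F) = Polynomial.aeval (RatFunc.X)⁻¹ (q i)) →
      (∀ i, (v i : F) = (q i).coeff 0) →
      D (MilnorSymbol u) = MilnorSymbol v) ∧
  (∀ q : Fin (n + 1) → F[X], (∀ i, (q i).coeff 0 ≠ 0) →
    ∀ u : Fin (n + 1) → (RatFunc F)ˣ,
      (∀ i, (u i : RatFunc F) = Polynomial.aeval (RatFunc.X)⁻¹ (q i)) →
      D (MilnorSymbol u) = 0)

section MilnorSymbol

open Function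

variable {R : Type*} [CommRing R] {n : ℕ}

theorem milnorSymbol_update_mul (f : Fin n → Rˣ) (i : Fin n) (a b : Rˣ) :
    MilnorSymbol (update f i (a * b)) =
      MilnorSymbol (update f i a) + MilnorSymbol (update f i b) := by
  have h : FreeAbelianGroup.of (update f i (a * b)) - FreeAbelianGroup.of (update f i a)
      - FreeAbelianGroup.of (update f i b) ∈ MilnorRel R n :=
    AddSubgroup.subset_closure (Or.inl ⟨update f i (a * b), i, a, b, by simp, by simp⟩)
  have h' := (QuotientAddGroup.eq_zero_iff _).2 h
  rw [sub_sub] at h'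
  exact sub_eq_zero.1 h'

/-- The symbol as a homomorphism in its `i`-th entry. -/
def milnorSymbolSlot (f : Fin n → Rˣ) (i : Fin n) : Rˣ →* Multiplicative (MilnorK R n) :=
  MonoidHom.mk' (fun a => Multiplicative.ofAdd (MilnorSymbol (update f i a)))
    (milnorSymbol_update_mul f i)

theorem milnorSymbol_update_one (f : Fin n → Rˣ) (i : Fin n) :
    MilnorSymbol (update f i 1) = 0 :=
  map_one (milnorSymbolSlot f i)

theorem milnorSymbol_update_inv (f : Fin n → Rˣ) (i : Fin n) (a : Rˣ) :
    MilnorSymbol (update f i a⁻¹) = -MilnorSymbol (update f i a) :=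
  map_inv (milnorSymbolSlot f i) a

theorem milnorSymbol_update_div (f : Fin n → Rˣ) (i : Fin n) (a b : Rˣ) :
    MilnorSymbol (update f i (a / b)) =
      MilnorSymbol (update f i a) - MilnorSymbol (update f i b) :=
  map_div (milnorSymbolSlot f i) a b

theorem milnorSymbol_eq_zero_of_adjacent_add_eq_one {f : Fin n → Rˣ} {i j : Fin n}
    (hij : (i : ℕ) + 1 = j) (h : (f i : R) + f j = 1) : MilnorSymbol f = 0 :=
  (QuotientAddGroup.eq_zero_iff _).2 (AddSubgroup.subset_closure (Or.inr ⟨f, i, j, hij, h, rfl⟩))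

/-- Symbols with entries in generated subgroups lie in every subgroup containing the symbols of
the generators. -/
theorem milnorSymbol_mem_of_mem_closure {A : AddSubgroup (MilnorK R n)} {S : Fin n → Set Rˣ}
    (hS : ∀ f : Fin n → Rˣ, (∀ i, f i ∈ S i) → MilnorSymbol f ∈ A) {f : Fin n → Rˣ}
    (hf : ∀ i, f i ∈ Subgroup.closure (S i)) : MilnorSymbol f ∈ A := by
  classical
  suffices H : ∀ s : Finset (Fin n), ∀ f : Fin n → Rˣ, (∀ i ∈ s, f i ∈ Subgroup.closure (S i)) →
      (∀ i ∉ s, f i ∈ S i) → MilnorSymbol f ∈ A from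
    H Finset.univ f (fun i _ => hf i) (fun i hi => absurd (Finset.mem_univ i) hi)
  intro s
  induction s using Finset.induction_on with
  | empty => exact fun f _ h => hS f fun i => h i (Finset.notMem_empty i)
  | insert i s his ih =>
    intro f h₁ h₂
    have key : ∀ a ∈ Subgroup.closure (S i), MilnorSymbol (update f i a) ∈ A := by
      intro a ha
      induction ha using Subgroup.closure_induction with
      | mem a ha =>
        refine ih _ (fun k hk => ?_) (fun k hk => ?_)
        · have hki : k ≠ i := fun h => his (h ▸ hk)
          simpa [hki] using h₁ k (Finset.mem_insert_of_mem hk)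
        · by_cases hki : k = i
          · subst hki; simpa using ha
          · simpa [hki] using h₂ k (by simp [hki, hk])
      | one => rw [milnorSymbol_update_one]; exact zero_mem A
      | mul a b _ _ ha hb => rw [milnorSymbol_update_mul]; exact add_mem ha hb
      | inv a _ ha => rw [milnorSymbol_update_inv]; exact neg_mem ha
    simpa using key (f i) (h₁ i (Finset.mem_insert_self i s))

end MilnorSymbol

section MilnorSymbolField

open Function

variable {K : Type*} [Field K] {n : ℕ}

theorem milnorSymbol_eq_zero_of_adjacent_eq_neg {f : Fin n → Kˣ} {i j : Fin n}
    (hij : (i : ℕ) + 1 = j) (h : f j = -f i) : MilnorSymbol f = 0 := by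
  have hne : i ≠ j := by rintro rfl; omega
  obtain ⟨a, ha⟩ : ∃ a, f i = a := ⟨_, rfl⟩
  by_cases h1 : a = 1
  · rw [← update_eq_self i f, ha, h1, milnorSymbol_update_one]
  have h1' : (a : K) ≠ 1 := fun h => h1 (Units.ext h)
  have hu : (1 - a : K) ≠ 0 := sub_ne_zero.2 (Ne.symm h1')
  have hw : (1 - (a : K)⁻¹) ≠ 0 := sub_ne_zero.2 fun h => h1' (inv_eq_one.1 h.symm)
  have hdiv : f j = Units.mk0 _ hu / Units.mk0 _ hw := by
    rw [h, ha, eq_div_iff_mul_eq']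
    ext
    have := a.ne_zero
    simp only [Units.val_mul, Units.val_neg, Units.val_mk0]
    field_simp
    ring
  rw [← update_eq_self j f, hdiv, milnorSymbol_update_div,
    milnorSymbol_eq_zero_of_adjacent_add_eq_one hij (by simp [hne, ha]), zero_sub, neg_eq_zero]
  have h2 : MilnorSymbol (update (update f j (Units.mk0 _ hw)) i a⁻¹) = 0 :=
    milnorSymbol_eq_zero_of_adjacent_add_eq_one hij (by simp [hne.symm])
  rwa [milnorSymbol_update_inv, neg_eq_zero, update_comm hne.symm,
    show update f i a = f by rw [← ha, update_eq_self]] at h2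

theorem milnorSymbol_comp_swap_adjacent (f : Fin n → Kˣ) {i j : Fin n} (hij : (i : ℕ) + 1 = j) :
    MilnorSymbol (f ∘ Equiv.swap i j) = -MilnorSymbol f := by
  have hne : i ≠ j := by rintro rfl; omega
  let B (x y : Kˣ) : MilnorK K n := MilnorSymbol (update (update f i x) j y)
  have hB₁ (x y z : Kˣ) : B (x * y) z = B x z + B y z := by
    simp only [B, update_comm hne, milnorSymbol_update_mul]
  have hB₂ (x y z : Kˣ) : B x (y * z) = B x y + B x z := milnorSymbol_update_mul _ _ _ _
  have hB₃ (x : Kˣ) : B x (-x) = 0 :=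
    milnorSymbol_eq_zero_of_adjacent_eq_neg hij (by simp [hne])
  have h := hB₃ (f i * f j)
  have e₁ : -(f i * f j) = -f i * f j := by simp
  have e₂ : -(f i * f j) = -f j * f i := by simp [mul_comm]
  rw [hB₁] at h
  nth_rewrite 1 [e₁] at h
  rw [e₂, hB₂, hB₂, hB₃, hB₃, zero_add, zero_add] at h
  have b₁ : B (f i) (f j) = MilnorSymbol f := by simp [B]
  have b₂ : B (f j) (f i) = MilnorSymbol (f ∘ Equiv.swap i j) := by
    rw [Equiv.comp_swap_eq_update, update_comm hne.symm]
  rw [b₁, b₂] at h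
  exact eq_neg_of_add_eq_zero_right h

theorem milnorSymbol_comp_perm (f : Fin n → Kˣ) (σ : Equiv.Perm (Fin n)) :
    MilnorSymbol (f ∘ σ) = MilnorSymbol f ∨ MilnorSymbol (f ∘ σ) = -MilnorSymbol f := by
  cases n with
  | zero => left; congr 1; exact Subsingleton.elim _ _
  | succ n =>
    have hσ : σ ∈ Submonoid.closure
        (Set.range fun i : Fin n => Equiv.swap i.castSucc i.succ) := by
      rw [Equiv.Perm.mclosure_swap_castSucc_succ]; trivial
    induction hσ using Submonoid.closure_induction generalizing f with
    | mem σ h =>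
      obtain ⟨i, rfl⟩ := h
      exact Or.inr (milnorSymbol_comp_swap_adjacent f (by simp))
    | one => exact Or.inl rfl
    | mul σ τ _ _ hσ hτ =>
      rw [Equiv.Perm.coe_mul, ← comp_assoc]
      rcases hσ f with h | h <;> rcases hτ (f ∘ σ) with h' | h' <;> simp [h, h']

theorem milnorSymbol_mem_of_comp_perm_mem {A : AddSubgroup (MilnorK K n)} {f : Fin n → Kˣ}
    (σ : Equiv.Perm (Fin n)) (h : MilnorSymbol (f ∘ σ) ∈ A) : MilnorSymbol f ∈ A := by
  rcases milnorSymbol_comp_perm f σ with h' | h' <;> rw [h'] at h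
  · exact h
  · exact neg_mem_iff.1 h

/-- A vanishing criterion for two adjacent entries holds for any two distinct entries. -/
theorem milnorSymbol_eq_zero_of_adjacent {Q : Kˣ → Kˣ → Prop}
    (hQ : ∀ (f : Fin n → Kˣ) (i j : Fin n), (i : ℕ) + 1 = j → Q (f i) (f j) → MilnorSymbol f = 0)
    {f : Fin n → Kˣ} {i j : Fin n} (hij : i ≠ j) (h : Q (f i) (f j)) : MilnorSymbol f = 0 := by
  obtain _ | _ | n := n
  · exact i.elim0
  · exact absurd (Subsingleton.elim (α := Fin 1) i j) hij
  let σ : Equiv.Perm (Fin (n + 2)) := Equiv.swap 0 i * Equiv.swap 1 (Equiv.swap 0 i j)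
  have h₁ : σ 1 = j := by simp [σ]
  have h₀ : σ 0 = i := by
    have hk : (0 : Fin (n + 2)) ≠ Equiv.swap 0 i j := by
      intro h
      apply hij
      simpa using congrArg (Equiv.swap 0 i) h
    simp only [σ, Equiv.Perm.coe_mul, comp_apply]
    rw [Equiv.swap_apply_of_ne_of_ne Fin.zero_ne_one hk, Equiv.swap_apply_left]
  have h0 : MilnorSymbol (f ∘ σ) = 0 := hQ _ 0 1 (by simp) (by simpa [h₀, h₁] using h)
  exact (AddSubgroup.mem_bot).1
    (milnorSymbol_mem_of_comp_perm_mem σ (AddSubgroup.mem_bot.2 h0))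

theorem milnorSymbol_eq_zero_of_add_eq_one {f : Fin n → Kˣ} {i j : Fin n} (hij : i ≠ j)
    (h : (f i : K) + f j = 1) : MilnorSymbol f = 0 :=
  milnorSymbol_eq_zero_of_adjacent (Q := fun a b : Kˣ => (a : K) + b = 1)
    (fun _ _ _ => milnorSymbol_eq_zero_of_adjacent_add_eq_one) hij h

theorem milnorSymbol_eq_zero_of_eq_neg {f : Fin n → Kˣ} {i j : Fin n} (hij : i ≠ j)
    (h : f j = -f i) : MilnorSymbol f = 0 :=
  milnorSymbol_eq_zero_of_adjacent (Q := fun a b : Kˣ => b = -a)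
    (fun _ _ _ => milnorSymbol_eq_zero_of_adjacent_eq_neg) hij h

end MilnorSymbolField

section Filtration

open Function

variable {F : Type*} [Field F] {n : ℕ}

theorem isCoprime_of_natDegree_lt {p q : F[X]} (hq : Irreducible q) (hp : p ≠ 0)
    (h : p.natDegree < q.natDegree) : IsCoprime p q :=
  ((hq.coprime_iff_not_dvd).2 fun hd =>
    (Polynomial.natDegree_le_of_dvd hd hp).not_gt h).symm

theorem eq_of_mk_eq_mk_of_natDegree_lt {p p' q : F[X]} (hp : p.natDegree < q.natDegree)
    (hp' : p'.natDegree < q.natDegree)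
    (h : Ideal.Quotient.mk (Ideal.span {q}) p = Ideal.Quotient.mk (Ideal.span {q}) p') :
    p = p' := by
  rw [Ideal.Quotient.mk_eq_mk_iff_sub_mem, Ideal.mem_span_singleton] at h
  by_contra hne
  exact (Polynomial.natDegree_le_of_dvd h (sub_ne_zero.2 hne)).not_gt
    ((Polynomial.natDegree_sub_le _ _).trans_lt (max_lt hp hp'))

theorem ne_zero_of_mk_eq_unit {p q : F[X]} (hq : Irreducible q)
    {v : (F[X] ⧸ Ideal.span {q})ˣ}
    (h : Ideal.Quotient.mk (Ideal.span {q}) p = v) : p ≠ 0 := by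
  have : Nontrivial (F[X] ⧸ Ideal.span {q}) :=
    Ideal.Quotient.nontrivial_iff.2 (by
      rw [Ne, Ideal.span_singleton_eq_top]; exact hq.not_isUnit)
  rintro rfl
  exact v.ne_zero (by rw [← h, map_zero])

theorem exists_natDegree_lt_mk_eq {q : F[X]} (hm : q.Monic) (hq : Irreducible q)
    (v : F[X] ⧸ Ideal.span {q}) :
    ∃ p : F[X], p.natDegree < q.natDegree ∧ Ideal.Quotient.mk (Ideal.span {q}) p = v := by
  obtain ⟨p, rfl⟩ := Ideal.Quotient.mk_surjective v
  refine ⟨p %ₘ q, Polynomial.natDegree_modByMonic_lt p hm hq.ne_one, ?_⟩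
  rw [Ideal.Quotient.mk_eq_mk_iff_sub_mem, Ideal.mem_span_singleton]
  exact ⟨-(p /ₘ q), by linear_combination Polynomial.modByMonic_add_div p q⟩

/-- A nonzero polynomial as a unit of the field of rational functions. -/
noncomputable def polyUnit (p : F[X]) (hp : p ≠ 0) : (RatFunc F)ˣ :=
  Units.mk0 (algebraMap F[X] (RatFunc F) p) (RatFunc.algebraMap_ne_zero hp)

@[simp]
theorem val_polyUnit (p : F[X]) (hp : p ≠ 0) :
    (polyUnit p hp : RatFunc F) = algebraMap F[X] (RatFunc F) p := rfl

theorem ne_zero_of_val_eq_algebraMap {u : (RatFunc F)ˣ} {p : F[X]}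
    (h : (u : RatFunc F) = algebraMap F[X] (RatFunc F) p) : p ≠ 0 := by
  rintro rfl
  exact u.ne_zero (by rw [h, map_zero])

variable (F) in
/-- Nonzero polynomials of degree less than `d`. -/
def polyUnitsDegLT (d : ℕ) : Set (RatFunc F)ˣ :=
  {u | ∃ p : F[X], p.natDegree < d ∧ (u : RatFunc F) = algebraMap F[X] (RatFunc F) p}

variable (F) in
/-- Monic irreducible polynomials of degree `d`. -/
def monicIrreducibleUnits (d : ℕ) : Set (RatFunc F)ˣ :=
  {u | ∃ p : F[X], p.Monic ∧ Irreducible p ∧ p.natDegree = d ∧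
    (u : RatFunc F) = algebraMap F[X] (RatFunc F) p}

variable (F n) in
/-- Milnor's filtration: the subgroup generated by the symbols of polynomials of degree less
than `d`. -/
noncomputable def milnorFiltration (d : ℕ) : AddSubgroup (MilnorK (RatFunc F) n) :=
  AddSubgroup.closure {x | ∃ u : Fin n → (RatFunc F)ˣ,
    (∀ i, u i ∈ polyUnitsDegLT F d) ∧ x = MilnorSymbol u}

theorem milnorSymbol_mem_milnorFiltration {d : ℕ} {u : Fin n → (RatFunc F)ˣ}
    (h : ∀ i, u i ∈ Subgroup.closure (polyUnitsDegLT F d)) :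
    MilnorSymbol u ∈ milnorFiltration F n d :=
  milnorSymbol_mem_of_mem_closure (A := milnorFiltration F n d)
    (S := fun _ => polyUnitsDegLT F d) (fun f hf => AddSubgroup.subset_closure ⟨f, hf, rfl⟩) h

theorem milnorFiltration_mono {d e : ℕ} (h : d ≤ e) :
    milnorFiltration F n d ≤ milnorFiltration F n e := by
  refine AddSubgroup.closure_mono ?_
  rintro _ ⟨u, hu, rfl⟩
  refine ⟨u, fun i => ?_, rfl⟩
  obtain ⟨p, hp, hup⟩ := hu i
  exact ⟨p, hp.trans_le h, hup⟩

theorem exists_mem_milnorFiltration (x : MilnorK (RatFunc F) n) :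
    ∃ d, x ∈ milnorFiltration F n d := by
  obtain ⟨y, rfl⟩ := QuotientAddGroup.mk_surjective x
  induction y using FreeAbelianGroup.induction_on with
  | zero => exact ⟨0, zero_mem _⟩
  | of u =>
    let d := Finset.univ.sup fun i =>
      max (u i : RatFunc F).num.natDegree (u i : RatFunc F).denom.natDegree
    refine ⟨d + 1, milnorSymbol_mem_milnorFiltration fun i => ?_⟩
    have hd : max (u i : RatFunc F).num.natDegree (u i : RatFunc F).denom.natDegree ≤ d :=
      Finset.le_sup (f := fun i =>
        max (u i : RatFunc F).num.natDegree (u i : RatFunc F).denom.natDegree) (Finset.mem_univ i)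
    have hnum : (u i : RatFunc F).num ≠ 0 := RatFunc.num_ne_zero (u i).ne_zero
    have hu : u i = polyUnit _ hnum / polyUnit _ (RatFunc.denom_ne_zero (u i : RatFunc F)) := by
      ext
      simp [RatFunc.num_div_denom]
    rw [hu]
    exact div_mem
      (Subgroup.subset_closure ⟨_, Nat.lt_succ_of_le ((le_max_left _ _).trans hd), rfl⟩)
      (Subgroup.subset_closure ⟨_, Nat.lt_succ_of_le ((le_max_right _ _).trans hd), rfl⟩)
  | neg u h =>
    obtain ⟨d, hd⟩ := h
    exact ⟨d, neg_mem hd⟩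
  | add y z hy hz =>
    obtain ⟨d, hd⟩ := hy
    obtain ⟨e, he⟩ := hz
    exact ⟨max d e, add_mem (milnorFiltration_mono (le_max_left d e) hd)
      (milnorFiltration_mono (le_max_right d e) he)⟩

theorem IsTameSymbol.eq_zero_of_mem_milnorFiltration {q : F[X]} (hq : Irreducible q)
    {D : MilnorK (RatFunc F) (n + 1) →+ MilnorK (F[X] ⧸ Ideal.span {q}) n}
    (hD : IsTameSymbol F n q D) {x : MilnorK (RatFunc F) (n + 1)}
    (hx : x ∈ milnorFiltration F (n + 1) q.natDegree) : D x = 0 := by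
  suffices milnorFiltration F (n + 1) q.natDegree ≤ D.ker from this hx
  rw [milnorFiltration, AddSubgroup.closure_le]
  rintro _ ⟨u, hu, rfl⟩
  choose p hp hup using hu
  exact hD.2 p (fun i =>
    isCoprime_of_natDegree_lt hq (ne_zero_of_val_eq_algebraMap (hup i)) (hp i)) u hup

theorem IsTameSymbolInf.eq_zero_of_mem_milnorFiltration
    {D : MilnorK (RatFunc F) (n + 1) →+ MilnorK F n} (hD : IsTameSymbolInf F n D)
    {x : MilnorK (RatFunc F) (n + 1)} (hx : x ∈ milnorFiltration F (n + 1) 1) : D x = 0 := by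
  suffices milnorFiltration F (n + 1) 1 ≤ D.ker from this hx
  rw [milnorFiltration, AddSubgroup.closure_le]
  rintro _ ⟨u, hu, rfl⟩
  choose p hp hup using hu
  have hC (i) : p i = C ((p i).coeff 0) :=
    Polynomial.eq_C_of_natDegree_eq_zero (Nat.lt_one_iff.1 (hp i))
  refine hD.2 p (fun i h => ?_) u (fun i => ?_)
  · exact ne_zero_of_val_eq_algebraMap (hup i) (by rw [hC i, h, map_zero])
  · rw [hup i, hC i, Polynomial.aeval_C, Polynomial.C_eq_algebraMap,
      ← IsScalarTower.algebraMap_apply]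

/-- If `c ≡ a * b` modulo `q`, where `a`, `b`, `c` are nonzero of degree less than `deg q`, then
`{q, …, a * b / c, …}` lies in the filtration step of degree less than `deg q`. -/
theorem milnorSymbol_mem_milnorFiltration_of_dvd {q a b c : F[X]}
    (ha : a.natDegree < q.natDegree) (hb : b.natDegree < q.natDegree)
    (hc : c.natDegree < q.natDegree) (ha₀ : a ≠ 0) (hb₀ : b ≠ 0) (hc₀ : c ≠ 0)
    (h : q ∣ c - a * b) {u : Fin (n + 1) → (RatFunc F)ˣ}
    (hu₀ : (u 0 : RatFunc F) = algebraMap F[X] (RatFunc F) q)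
    (hu : ∀ i ≠ 0, u i ∈ Subgroup.closure (polyUnitsDegLT F q.natDegree))
    {j : Fin (n + 1)} (hj : j ≠ 0)
    (huj : u j = polyUnit a ha₀ * polyUnit b hb₀ / polyUnit c hc₀) :
    MilnorSymbol u ∈ milnorFiltration F (n + 1) q.natDegree := by
  obtain ⟨e, he⟩ := h
  by_cases he₀ : e = 0
  · have h1 : u j = 1 := by
      rw [huj, div_eq_one]
      ext
      rw [he₀, mul_zero, sub_eq_zero] at he
      simp [he]
    rw [← update_eq_self j u, h1, milnorSymbol_update_one]
    exact zero_mem _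
  have hq₀ : q ≠ 0 := ne_zero_of_val_eq_algebraMap hu₀
  have hed : e.natDegree < q.natDegree := by
    have h₁ := Polynomial.natDegree_mul hq₀ he₀
    have h₂ := Polynomial.natDegree_sub_le c (a * b)
    rw [Polynomial.natDegree_mul ha₀ hb₀, he, h₁] at h₂
    rcases le_max_iff.1 h₂ with h₂ | h₂ <;> omega
  have hst : MilnorSymbol (update u 0 (u 0 * (polyUnit e he₀ / polyUnit c hc₀))) = 0 := by
    refine milnorSymbol_eq_zero_of_add_eq_one (i := 0) (j := j) hj.symm ?_
    have hc' : algebraMap F[X] (RatFunc F) c ≠ 0 := RatFunc.algebraMap_ne_zero hc₀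
    have he' := congrArg (algebraMap F[X] (RatFunc F)) he
    simp only [map_sub, map_mul] at he'
    simp only [update_self, update_of_ne hj, huj, Units.val_mul, Units.val_div_eq_div_val, hu₀,
      val_polyUnit]
    field_simp
    linear_combination -he'
  rw [milnorSymbol_update_mul, update_eq_self] at hst
  rw [eq_neg_of_add_eq_zero_left hst]
  refine neg_mem (milnorSymbol_mem_milnorFiltration fun i => ?_)
  by_cases hi : i = 0
  · subst hi
    rw [update_self]
    exact div_mem (Subgroup.subset_closure ⟨e, hed, rfl⟩) (Subgroup.subset_closure ⟨c, hc, rfl⟩)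
  · rw [update_of_ne hi]
    exact hu i hi

/-- The homomorphism `{g₁, …, gₙ} ↦ {q, g₁, …, gₙ}` from the Milnor K-theory of the residue field
of `q` to the graded piece of the filtration. -/
theorem exists_residue_lift {q : F[X]} (hm : q.Monic) (hq : Irreducible q) :
    ∃ h : MilnorK (F[X] ⧸ Ideal.span {q}) n →+
        MilnorK (RatFunc F) (n + 1) ⧸ milnorFiltration F (n + 1) q.natDegree,
      ∀ (p : Fin n → F[X]) (v : Fin n → (F[X] ⧸ Ideal.span {q})ˣ)
        (u : Fin (n + 1) → (RatFunc F)ˣ), (∀ i, (p i).natDegree < q.natDegree) →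
        (∀ i, (v i : F[X] ⧸ Ideal.span {q}) = Ideal.Quotient.mk (Ideal.span {q}) (p i)) →
        (u 0 : RatFunc F) = algebraMap F[X] (RatFunc F) q →
        (∀ i : Fin n, (u i.succ : RatFunc F) = algebraMap F[X] (RatFunc F) (p i)) →
        h (MilnorSymbol v) = QuotientAddGroup.mk (MilnorSymbol u) := by
  choose r hr hrv using fun v : (F[X] ⧸ Ideal.span {q})ˣ =>
    exists_natDegree_lt_mk_eq hm hq (v : F[X] ⧸ Ideal.span {q})
  have hr₀ (v) : r v ≠ 0 := ne_zero_of_mk_eq_unit hq (hrv v)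
  let ρ (v : (F[X] ⧸ Ideal.span {q})ˣ) : (RatFunc F)ˣ := polyUnit (r v) (hr₀ v)
  let Φ (v : Fin n → (F[X] ⧸ Ideal.span {q})ˣ) : Fin (n + 1) → (RatFunc F)ˣ :=
    Fin.cons (polyUnit q hm.ne_zero) (ρ ∘ v)
  let φ (v : Fin n → (F[X] ⧸ Ideal.span {q})ˣ) :
      MilnorK (RatFunc F) (n + 1) ⧸ milnorFiltration F (n + 1) q.natDegree :=
    QuotientAddGroup.mk (MilnorSymbol (Φ v))
  have hΦ (v i c) : Φ (update v i c) = update (Φ v) i.succ (ρ c) := by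
    simp only [Φ, Function.comp_update, Fin.cons_update]
  have hker : MilnorRel (F[X] ⧸ Ideal.span {q}) n ≤ (FreeAbelianGroup.lift φ).ker := by
    rw [MilnorRel, AddSubgroup.closure_le]
    rintro _ (⟨v, i, a, b, hab, rfl⟩ | ⟨v, i, j, hij, hv, rfl⟩)
    · have hmem : MilnorSymbol (update (Φ v) i.succ (ρ a * ρ b / ρ (a * b))) ∈
          milnorFiltration F (n + 1) q.natDegree := by
        refine milnorSymbol_mem_milnorFiltration_of_dvd (hr a) (hr b) (hr (a * b)) (hr₀ a) (hr₀ b)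
          (hr₀ (a * b)) ?_ ?_ ?_ (Fin.succ_ne_zero i) (update_self _ _ _)
        · rw [← Ideal.mem_span_singleton, ← Ideal.Quotient.mk_eq_mk_iff_sub_mem, map_mul, hrv, hrv,
            hrv, Units.val_mul]
        · simp [Φ, update_of_ne (Fin.succ_ne_zero i).symm]
        · have hρ (c) : ρ c ∈ Subgroup.closure (polyUnitsDegLT F q.natDegree) :=
            Subgroup.subset_closure ⟨r c, hr c, rfl⟩
          intro k hk
          by_cases hki : k = i.succ
          · subst hki
            rw [update_self]
            exact div_mem (mul_mem (hρ a) (hρ b)) (hρ (a * b))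
          · rw [update_of_ne hki]
            obtain ⟨k, rfl⟩ := Fin.exists_succ_eq.2 hk
            exact hρ (v k)
      rw [milnorSymbol_update_div, milnorSymbol_update_mul, ← hΦ, ← hΦ, ← hΦ, ← hab,
        update_eq_self] at hmem
      have h0 := (QuotientAddGroup.eq_zero_iff _).2 (neg_mem hmem)
      rw [SetLike.mem_coe, AddMonoidHom.mem_ker, map_sub, map_sub, FreeAbelianGroup.lift_apply_of,
        FreeAbelianGroup.lift_apply_of, FreeAbelianGroup.lift_apply_of, sub_sub]
      rwa [neg_sub] at h0
    · have hsum : r (v i) + r (v j) = 1 := by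
        refine eq_of_mk_eq_mk_of_natDegree_lt
          ((Polynomial.natDegree_add_le _ _).trans_lt (max_lt (hr _) (hr _)))
          (by simpa using hq.natDegree_pos) ?_
        rw [map_add, hrv, hrv, hv, map_one]
      have h0 : MilnorSymbol (Φ v) = 0 := by
        refine milnorSymbol_eq_zero_of_adjacent_add_eq_one (i := i.succ) (j := j.succ)
          (by simp [hij]) ?_
        simp only [Φ, Fin.cons_succ, comp_apply, ρ, val_polyUnit]
        rw [← map_add, hsum, map_one]
      rw [SetLike.mem_coe, AddMonoidHom.mem_ker, FreeAbelianGroup.lift_apply_of]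
      simp only [φ, h0]
      rfl
  refine ⟨QuotientAddGroup.lift _ (FreeAbelianGroup.lift φ) hker, fun p v u hp hv hu₀ hu => ?_⟩
  have hu' : u = Φ v := by
    ext i
    induction i using Fin.cases with
    | zero => rw [hu₀]; rfl
    | succ i =>
      rw [hu, eq_of_mk_eq_mk_of_natDegree_lt (hp i) (hr (v i)) ((hv i).symm.trans (hrv _).symm)]
      rfl
  rw [hu']
  exact FreeAbelianGroup.lift_apply_of φ v

theorem subset_closure_polyUnitsDegLT_union {d : ℕ} (hd : 0 < d) :
    polyUnitsDegLT F (d + 1) ⊆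
      Subgroup.closure (polyUnitsDegLT F d ∪ monicIrreducibleUnits F d) := by
  rintro u ⟨p, hp, hup⟩
  have hp₀ : p ≠ 0 := ne_zero_of_val_eq_algebraMap hup
  have hlow {a : F[X]} (ha₀ : a ≠ 0) (ha : a.natDegree < d) :
      polyUnit a ha₀ ∈ Subgroup.closure (polyUnitsDegLT F d ∪ monicIrreducibleUnits F d) :=
    Subgroup.subset_closure (Or.inl ⟨a, ha, rfl⟩)
  rcases (Nat.lt_succ_iff.1 hp).lt_or_eq with hlt | heq
  · exact Subgroup.subset_closure (Or.inl ⟨p, hlt, hup⟩)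
  by_cases hirr : Irreducible p
  · have hl : p.leadingCoeff ≠ 0 := Polynomial.leadingCoeff_ne_zero.2 hp₀
    have hm := Polynomial.monic_mul_leadingCoeff_inv hp₀
    have hu : u = polyUnit (p * C p.leadingCoeff⁻¹) hm.ne_zero *
        polyUnit (C p.leadingCoeff) (Polynomial.C_ne_zero.2 hl) := by
      ext
      rw [hup, Units.val_mul, val_polyUnit, val_polyUnit, ← map_mul, mul_assoc, ← C_mul,
        inv_mul_cancel₀ hl, C_1, mul_one]
    rw [hu]
    refine mul_mem (Subgroup.subset_closure (Or.inr ⟨_, hm,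
      Polynomial.irreducible_mul_leadingCoeff_inv.2 hirr, ?_, rfl⟩))
      (hlow _ (by rwa [Polynomial.natDegree_C]))
    rw [Polynomial.natDegree_mul_C (inv_ne_zero hl), heq]
  · have hnu : ¬IsUnit p := fun h => hd.ne' (heq ▸ Polynomial.natDegree_eq_zero_of_isUnit h)
    have : ∃ a b : F[X], p = a * b ∧ ¬IsUnit a ∧ ¬IsUnit b := by
      by_contra! H
      exact hirr ⟨hnu, fun a b hab => or_iff_not_imp_left.2 (H a b hab)⟩
    obtain ⟨a, b, rfl, ha, hb⟩ := this
    obtain ⟨ha₀, hb₀⟩ := mul_ne_zero_iff.1 hp₀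
    have hpos {c : F[X]} (hc₀ : c ≠ 0) (hc : ¬IsUnit c) : 0 < c.natDegree :=
      Nat.pos_of_ne_zero fun h => hc (Polynomial.isUnit_iff_degree_eq_zero.2
        ((Polynomial.degree_eq_iff_natDegree_eq hc₀).2 h))
    have hda := hpos ha₀ ha
    have hdb := hpos hb₀ hb
    rw [Polynomial.natDegree_mul ha₀ hb₀] at heq
    have hu : u = polyUnit a ha₀ * polyUnit b hb₀ := by
      ext
      simp [hup]
    rw [hu]
    exact mul_mem (hlow ha₀ (by omega)) (hlow hb₀ (by omega))

variable (F n) in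
/-- The symbols `{q, g₁, …, gₙ}` with `q` monic irreducible of degree `d` and `gᵢ` polynomials of
degree less than `d`. -/
def leadingSymbols (d : ℕ) : Set (MilnorK (RatFunc F) (n + 1)) :=
  {x | ∃ u : Fin (n + 1) → (RatFunc F)ˣ, u 0 ∈ monicIrreducibleUnits F d ∧
    (∀ i : Fin n, u i.succ ∈ polyUnitsDegLT F d) ∧ x = MilnorSymbol u}

/-- A symbol with two monic irreducible entries of degree `d` is a combination of symbols with one of
them replaced by polynomials of lower degree. -/
theorem milnorSymbol_mem_of_monicIrreducible_pair {d : ℕ} (hd : 0 < d)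
    {A : AddSubgroup (MilnorK (RatFunc F) n)} {f : Fin n → (RatFunc F)ˣ} {i j : Fin n}
    (hij : i ≠ j) (hi : f i ∈ monicIrreducibleUnits F d) (hj : f j ∈ monicIrreducibleUnits F d)
    (hA : ∀ x ∈ monicIrreducibleUnits F d, ∀ y ∈ Subgroup.closure (polyUnitsDegLT F d),
      MilnorSymbol (update (update f i x) j y) ∈ A) : MilnorSymbol f ∈ A := by
  let B (x y : (RatFunc F)ˣ) : MilnorK (RatFunc F) n := MilnorSymbol (update (update f i x) j y)
  have hdiv₁ (x y z : (RatFunc F)ˣ) : B (x / y) z = B x z - B y z := by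
    simp only [B, update_comm hij, milnorSymbol_update_div]
  have hdiv₂ (x y z : (RatFunc F)ˣ) : B x (y / z) = B x y - B x z :=
    milnorSymbol_update_div _ _ _ _
  have hself (x : (RatFunc F)ˣ) : B x x = B x (-1) := by
    have h : B x (-1 * x) = 0 := milnorSymbol_eq_zero_of_eq_neg hij (by simp [hij])
    have hneg : B x (-1) + B x (-1) = 0 := by
      have h' : B x (-1 * -1) = B x (-1) + B x (-1) := milnorSymbol_update_mul _ _ _ _
      rw [← h', neg_one_mul, neg_neg]
      exact milnorSymbol_update_one _ _
    have h' : B x (-1 * x) = B x (-1) + B x x := milnorSymbol_update_mul _ _ _ _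
    rw [h', ← hneg] at h
    exact add_left_cancel h
  have hself_mem {x} (hx : x ∈ monicIrreducibleUnits F d) : B x x ∈ A := by
    rw [hself]
    exact hA x hx _ (Subgroup.subset_closure ⟨-1, by simpa using hd, by simp⟩)
  have hf : B (f i) (f j) = MilnorSymbol f := by simp [B]
  rw [← hf]
  obtain ⟨p, hpm, -, hpd, hp⟩ := id hi
  obtain ⟨q, hqm, -, hqd, hq⟩ := id hj
  by_cases hpq : q - p = 0
  · have : f i = f j := by
      ext
      rw [hp, hq, sub_eq_zero.1 hpq]
    rw [this]
    exact hself_mem hj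
  have hlt : (q - p).natDegree < d := by
    have h : (q - p).degree < q.degree := Polynomial.degree_sub_lt_left
      (by rw [Polynomial.degree_eq_natDegree hqm.ne_zero,
        Polynomial.degree_eq_natDegree hpm.ne_zero, hpd, hqd]) hqm.ne_zero
      (by rw [hpm.leadingCoeff, hqm.leadingCoeff])
    have := Polynomial.natDegree_lt_natDegree hpq h
    rwa [hqd] at this
  have he : polyUnit (q - p) hpq ∈ Subgroup.closure (polyUnitsDegLT F d) :=
    Subgroup.subset_closure ⟨q - p, hlt, rfl⟩
  have hst : B (f i / f j) (polyUnit (q - p) hpq / f j) = 0 := by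
    refine milnorSymbol_eq_zero_of_add_eq_one hij ?_
    have hq₀ : algebraMap F[X] (RatFunc F) q ≠ 0 := RatFunc.algebraMap_ne_zero hqm.ne_zero
    simp only [update_self, update_of_ne hij, Units.val_div_eq_div_val, hp, hq, val_polyUnit,
      map_sub]
    field_simp
    ring
  rw [hdiv₁, hdiv₂, hdiv₂] at hst
  have key : B (f i) (f j) = B (f i) (polyUnit (q - p) hpq) - B (f j) (polyUnit (q - p) hpq) +
      B (f j) (f j) := by
    rw [← sub_eq_zero, ← neg_eq_zero, ← hst]
    abel
  rw [key]
  exact add_mem (sub_mem (hA _ hi _ he) (hA _ hj _ he)) (hself_mem hj)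

theorem milnorFiltration_succ_le {d : ℕ} (hd : 0 < d) :
    milnorFiltration F (n + 1) (d + 1) ≤
      milnorFiltration F (n + 1) d ⊔ AddSubgroup.closure (leadingSymbols F n d) := by
  classical
  set A := milnorFiltration F (n + 1) d ⊔ AddSubgroup.closure (leadingSymbols F n d)
  set G := Subgroup.closure (polyUnitsDegLT F d)
  have key : ∀ s : Finset (Fin (n + 1)), ∀ f : Fin (n + 1) → (RatFunc F)ˣ,
      (∀ i, f i ∈ polyUnitsDegLT F d ∪ monicIrreducibleUnits F d ∨ f i ∈ G) →
      (∀ i ∉ s, f i ∈ G) → MilnorSymbol f ∈ A := by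
    intro s
    induction s using Finset.strongInduction with
    | H s ih =>
      intro f hf hs
      have hirr {i} (hi : f i ∉ G) : f i ∈ monicIrreducibleUnits F d := by
        rcases hf i with (h | h) | h
        · exact absurd (Subgroup.subset_closure h) hi
        · exact h
        · exact absurd h hi
      by_cases hall : ∀ i, f i ∈ G
      · exact AddSubgroup.mem_sup_left (milnorSymbol_mem_milnorFiltration hall)
      push Not at hall
      obtain ⟨j, hj⟩ := hall
      by_cases hone : ∀ i ≠ j, f i ∈ G
      · refine milnorSymbol_mem_of_comp_perm_mem (Equiv.swap 0 j) ?_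
        refine milnorSymbol_mem_of_mem_closure
          (S := Fin.cons {f j} fun _ => polyUnitsDegLT F d) (fun g hg => ?_) (fun i => ?_)
        · refine AddSubgroup.mem_sup_right (AddSubgroup.subset_closure ⟨g, ?_, fun i => ?_, rfl⟩)
          · have h0 : g 0 = f j := by simpa using hg 0
            rw [h0]
            exact hirr hj
          · simpa using hg i.succ
        · induction i using Fin.cases with
          | zero => exact Subgroup.subset_closure (by simp)
          | succ i =>
            rw [Fin.cons_succ, comp_apply]
            refine hone _ fun h => Fin.succ_ne_zero i ?_
            exact (Equiv.swap 0 j).injective (h.trans (Equiv.swap_apply_left 0 j).symm)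
      push Not at hone
      obtain ⟨i, hij, hi⟩ := hone
      refine milnorSymbol_mem_of_monicIrreducible_pair hd hij (hirr hi) (hirr hj)
        fun x hx y hy => ?_
      have hjs : j ∈ s := by_contra fun h => hj (hs j h)
      have his : i ∈ s := by_contra fun h => hi (hs i h)
      refine ih (s.erase j) (Finset.erase_ssubset hjs) _ (fun k => ?_) (fun k hk => ?_)
      · by_cases hkj : k = j
        · subst hkj
          rw [update_self]
          exact Or.inr hy
        by_cases hki : k = i
        · subst hki
          rw [update_of_ne hkj, update_self]
          exact Or.inl (Or.inr hx)
        · rw [update_of_ne hkj, update_of_ne hki]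
          exact hf k
      · by_cases hkj : k = j
        · subst hkj
          rwa [update_self]
        have hks : k ∉ s := fun h => hk (Finset.mem_erase.2 ⟨hkj, h⟩)
        rw [update_of_ne hkj, update_of_ne (ne_of_mem_of_not_mem his hks).symm]
        exact hs k hks
  rw [milnorFiltration, AddSubgroup.closure_le]
  rintro _ ⟨u, hu, rfl⟩
  exact milnorSymbol_mem_of_mem_closure
    (fun f hf => key Finset.univ f (fun i => Or.inl (hf i))
      (fun i hi => absurd (Finset.mem_univ i) hi))
    (fun i => subset_closure_polyUnitsDegLT_union hd (hu i))

/-- The composite of the tame symbol with the lift from the residue field to the graded piece. -/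
theorem IsTameSymbol.exists_lift {q : F[X]} (hm : q.Monic) (hq : Irreducible q)
    {D : MilnorK (RatFunc F) (n + 1) →+ MilnorK (F[X] ⧸ Ideal.span {q}) n}
    (hD : IsTameSymbol F n q D) :
    ∃ H : MilnorK (RatFunc F) (n + 1) →+
        MilnorK (RatFunc F) (n + 1) ⧸ milnorFiltration F (n + 1) q.natDegree,
      (∀ x, D x = 0 → H x = 0) ∧
      ∀ u : Fin (n + 1) → (RatFunc F)ˣ, (u 0 : RatFunc F) = algebraMap F[X] (RatFunc F) q →
        (∀ i : Fin n, u i.succ ∈ polyUnitsDegLT F q.natDegree) →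
        H (MilnorSymbol u) = QuotientAddGroup.mk (MilnorSymbol u) := by
  obtain ⟨h, hh⟩ := exists_residue_lift (n := n) hm hq
  refine ⟨h.comp D, fun x hx => by rw [AddMonoidHom.comp_apply, hx, map_zero],
    fun u hu₀ hu => ?_⟩
  choose p hp hup using hu
  have hcop (i) : IsCoprime (p i) q :=
    isCoprime_of_natDegree_lt hq (ne_zero_of_val_eq_algebraMap (hup i)) (hp i)
  have hunit (i) : IsUnit (Ideal.Quotient.mk (Ideal.span {q}) (p i)) := by
    obtain ⟨a, b, hab⟩ := hcop i
    refine IsUnit.of_mul_eq_one (Ideal.Quotient.mk _ a) ?_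
    rw [← map_mul, ← map_one (Ideal.Quotient.mk (Ideal.span {q})),
      Ideal.Quotient.mk_eq_mk_iff_sub_mem, Ideal.mem_span_singleton]
    exact ⟨-b, by linear_combination hab⟩
  rw [AddMonoidHom.comp_apply, hD.1 p hcop u (fun i => (hunit i).unit) hu₀ hup fun i => rfl]
  exact hh p _ u hp (fun i => rfl) hu₀ hup

/-- An element of the filtration step `d + 1` whose tame symbols of degree `d` vanish lies in the
filtration step `d`. -/
theorem mem_milnorFiltration_of_tameSymbol_eq_zero {d : ℕ} (hd : 0 < d)
    {D : ∀ q : F[X], MilnorK (RatFunc F) (n + 1) →+ MilnorK (F[X] ⧸ Ideal.span {q}) n}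
    (hD : ∀ q : F[X], q.Monic → Irreducible q → IsTameSymbol F n q (D q))
    {x : MilnorK (RatFunc F) (n + 1)} (hx : x ∈ milnorFiltration F (n + 1) (d + 1))
    (h : ∀ q : F[X], q.Monic → Irreducible q → q.natDegree = d → D q x = 0) :
    x ∈ milnorFiltration F (n + 1) d := by
  classical
  let P := {q : F[X] // q.Monic ∧ Irreducible q ∧ q.natDegree = d}
  have hlift (q : P) : ∃ H : MilnorK (RatFunc F) (n + 1) →+
        MilnorK (RatFunc F) (n + 1) ⧸ milnorFiltration F (n + 1) d,
      (∀ x, D q x = 0 → H x = 0) ∧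
      ∀ u : Fin (n + 1) → (RatFunc F)ˣ, (u 0 : RatFunc F) = algebraMap F[X] (RatFunc F) q →
        (∀ i : Fin n, u i.succ ∈ polyUnitsDegLT F d) →
        H (MilnorSymbol u) = QuotientAddGroup.mk (MilnorSymbol u) := by
    obtain ⟨q, hm, hq, rfl⟩ := q
    exact (hD q hm hq).exists_lift hm hq
  choose H hH₀ hH using hlift
  have key : ∀ y ∈ milnorFiltration F (n + 1) d ⊔ AddSubgroup.closure (leadingSymbols F n d),
      ∃ T : Finset P, ∀ S : Finset P, T ⊆ S →
        (QuotientAddGroup.mk y : MilnorK (RatFunc F) (n + 1) ⧸ milnorFiltration F (n + 1) d) =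
          ∑ q ∈ S, H q y := by
    intro y hy
    rw [← AddSubgroup.closure_eq (milnorFiltration F (n + 1) d), ← AddSubgroup.closure_union] at hy
    induction hy using AddSubgroup.closure_induction with
    | mem y hy =>
      rcases hy with hy | ⟨u, ⟨p, hm, hp, hpd, hup⟩, hu, rfl⟩
      · refine ⟨∅, fun S _ => ?_⟩
        rw [(QuotientAddGroup.eq_zero_iff y).2 hy, Finset.sum_eq_zero]
        intro q _
        refine hH₀ q y ((hD q q.2.1 q.2.2.1).eq_zero_of_mem_milnorFiltration q.2.2.1 ?_)
        rw [q.2.2.2]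
        exact hy
      · refine ⟨{⟨p, hm, hp, hpd⟩}, fun S hS => ?_⟩
        rw [Finset.sum_eq_single_of_mem ⟨p, hm, hp, hpd⟩ (hS (Finset.mem_singleton_self _)),
          hH _ u hup hu]
        intro q _ hqp
        refine hH₀ q _ ?_
        choose g hg hug using hu
        refine (hD q q.2.1 q.2.2.1).2 (Fin.cons p g) (fun i => ?_) u (fun i => ?_)
        · induction i using Fin.cases with
          | zero =>
            refine (hp.coprime_iff_not_dvd.2 fun hdvd => hqp (Subtype.ext ?_))
            exact (Polynomial.eq_of_monic_of_associated hm q.2.1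
              (hp.associated_of_dvd q.2.2.1 hdvd)).symm
          | succ i =>
            refine isCoprime_of_natDegree_lt q.2.2.1 (ne_zero_of_val_eq_algebraMap (hug i)) ?_
            rw [q.2.2.2]
            exact hg i
        · induction i using Fin.cases with
          | zero => exact hup
          | succ i => exact hug i
    | zero => exact ⟨∅, fun S _ => by simp⟩
    | add y z _ _ hy hz =>
      obtain ⟨T, hT⟩ := hy
      obtain ⟨T', hT'⟩ := hz
      refine ⟨T ∪ T', fun S hS => ?_⟩
      simp only [QuotientAddGroup.mk_add, map_add, Finset.sum_add_distrib,
        hT S (Finset.union_subset_left hS), hT' S (Finset.union_subset_right hS)]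
    | neg y _ hy =>
      obtain ⟨T, hT⟩ := hy
      refine ⟨T, fun S hS => ?_⟩
      simp only [QuotientAddGroup.mk_neg, map_neg, Finset.sum_neg_distrib, hT S hS]
  obtain ⟨T, hT⟩ := key x (milnorFiltration_succ_le hd hx)
  rw [← QuotientAddGroup.eq_zero_iff, hT T subset_rfl]
  exact Finset.sum_eq_zero fun q _ => hH₀ q x (h q q.2.1 q.2.2.1 q.2.2.2)

/-- An element of `K^M_{n+1}(F(t))` all of whose finite tame symbols vanish comes from `F`. -/
theorem mem_milnorFiltration_one_of_tameSymbol_eq_zero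
    {D : ∀ q : F[X], MilnorK (RatFunc F) (n + 1) →+ MilnorK (F[X] ⧸ Ideal.span {q}) n}
    (hD : ∀ q : F[X], q.Monic → Irreducible q → IsTameSymbol F n q (D q))
    {x : MilnorK (RatFunc F) (n + 1)}
    (h : ∀ q : F[X], q.Monic → Irreducible q → D q x = 0) :
    x ∈ milnorFiltration F (n + 1) 1 := by
  obtain ⟨d, hd⟩ := exists_mem_milnorFiltration x
  replace hd : x ∈ milnorFiltration F (n + 1) (d + 1) := milnorFiltration_mono d.le_succ hd
  induction d with
  | zero => exact hd
  | succ d ih =>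
    exact ih (mem_milnorFiltration_of_tameSymbol_eq_zero d.succ_pos hD hd
      fun q hm hq _ => h q hm hq)

end Filtration

/-- well-definedness of the Bass–Tate norm
`N_{L/F} : K^M_n(L) → K^M_n(F)` for `L = F[t]/(π)`: if `ζ₁, ζ₂ ∈ K^M_{n+1}(F(t))`
both have all tame symbols at monic irreducibles `π' ≠ π` equal to `0` and tame
symbol `ξ` at `π`, then `-∂_{1/t}(ζ₁) = -∂_{1/t}(ζ₂)`, so `N_{L/F}(ξ) := -∂_{1/t}(ζ)`
is independent of the choice of `ζ`. -/
theorem bass_tate_norm_well_defined (F : Type*) [Field F] (n : ℕ)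
    (π : F[X]) (hπ : π.Monic) (hirr : Irreducible π)
    (D : ∀ q : F[X],
      MilnorK (RatFunc F) (n + 1) →+ MilnorK (F[X] ⧸ Ideal.span {q}) n)
    (hD : ∀ q : F[X], q.Monic → Irreducible q → IsTameSymbol F n q (D q))
    (Dinf : MilnorK (RatFunc F) (n + 1) →+ MilnorK F n)
    (hDinf : IsTameSymbolInf F n Dinf)
    (ξ : MilnorK (F[X] ⧸ Ideal.span {π}) n)
    (ζ₁ ζ₂ : MilnorK (RatFunc F) (n + 1))
    (h₁ : ∀ q : F[X], q.Monic → Irreducible q → q ≠ π → D q ζ₁ = 0)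
    (h₁π : D π ζ₁ = ξ)
    (h₂ : ∀ q : F[X], q.Monic → Irreducible q → q ≠ π → D q ζ₂ = 0)
    (h₂π : D π ζ₂ = ξ) :
    -Dinf ζ₁ = -Dinf ζ₂ := by
  rw [neg_inj, ← sub_eq_zero, ← map_sub]
  refine hDinf.eq_zero_of_mem_milnorFiltration
    (mem_milnorFiltration_one_of_tameSymbol_eq_zero hD fun q hm hq => ?_)
  by_cases hqπ : q = π
  · subst hqπ
    rw [map_sub, h₁π, h₂π, sub_self]
  · rw [map_sub, h₁ q hm hq hqπ, h₂ q hm hq hqπ, sub_self]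
end
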